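/- In every planar geometric storyplan of the graph G, for each of the three 4-cycles A, B, C there is a time step at which all four of its vertices are simultaneously visible. -/

import Mathlib

/-- The straight-line drawing `D` of the subgraph of `G` induced by the visible
vertex set `S` is planar. -/
def IsPlanarSLFrame {V : Type*} (G : SimpleGraph V) (S : Set V) (D : V → ℝ × ℝ) : Prop :=
  Set.InjOn D S ∧
  (∀ u v w, G.Adj u v → u ∈ S → v ∈ S → w ∈ S → w ≠ u → w ≠ v →
      D w ∉ openSegment ℝ (D u) (D v)) ∧
  (∀ u v x y, G.Adj u v → G.Adj x y → u ∈ S → v ∈ S → x ∈ S → y ∈ S →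
      ¬((u = x ∧ v = y) ∨ (u = y ∧ v = x)) →
      ∀ p ∈ segment ℝ (D u) (D v) ∩ segment ℝ (D x) (D y),
        ∃ z, (z = u ∨ z = v) ∧ (z = x ∨ z = y) ∧ p = D z)

/-- `(len, s, e, D)` is a planar geometric storyplan of `G`: `len ≥ 1` time steps,
each vertex `v` is visible on the nonempty interval `[s v, e v] ⊆ [1, len]`,
the endpoints of every edge co-occur, and every frame is a planar
straight-line drawing. -/
def IsGeomStoryplan {V : Type*} (G : SimpleGraph V)
    (len : ℕ) (s e : V → ℕ) (D : V → ℝ × ℝ) : Prop :=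
  1 ≤ len ∧
  (∀ v, 1 ≤ s v ∧ s v ≤ e v ∧ e v ≤ len) ∧
  (∀ u v, G.Adj u v → ∃ t, s u ≤ t ∧ t ≤ e u ∧ s v ≤ t ∧ t ≤ e v) ∧
  (∀ t, 1 ≤ t → t ≤ len → IsPlanarSLFrame G {v | s v ≤ t ∧ t ≤ e v} D)

/-- `G` admits a planar geometric storyplan. -/
def HasGeomStoryplan {V : Type*} (G : SimpleGraph V) : Prop :=
  ∃ len s e D, IsGeomStoryplan G len s e D

/-- The 28 vertices of the graph `G`: cycle vertices `a i`, `b i`, `c i`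
(`i ∈ Fin 4`), apex vertices `q i j` and edge vertices `r i j`
(`i ∈ Fin 4`, `j ∈ Fin 2`). -/
inductive GVert : Type
  | a : Fin 4 → GVert
  | b : Fin 4 → GVert
  | c : Fin 4 → GVert
  | q : Fin 4 → Fin 2 → GVert
  | r : Fin 4 → Fin 2 → GVert
  deriving DecidableEq

/-- Base relation generating the edges of `G`: the three 4-cycles
`A`, `B`, `C`; each apex vertex `q i j` adjacent to all twelve cycle vertices;
each edge vertex `r i j` adjacent to `q i j` and to the six cycle vertices
`a i, a (i+1), b i, b (i+1), c i, c (i+1)`. -/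
def GRel : GVert → GVert → Prop
  | .a i, .a k => k = i + 1
  | .b i, .b k => k = i + 1
  | .c i, .c k => k = i + 1
  | .q _ _, .a _ => True
  | .q _ _, .b _ => True
  | .q _ _, .c _ => True
  | .r i j, .q i' j' => i' = i ∧ j' = j
  | .r i _, .a k => k = i ∨ k = i + 1
  | .r i _, .b k => k = i ∨ k = i + 1
  | .r i _, .c k => k = i ∨ k = i + 1
  | _, _ => False

/-- The graph `G` from the paper (28 vertices). -/
def GraphG : SimpleGraph GVert := SimpleGraph.fromRel GRel

/-- Vertex `v` is visible at time `t`. -/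
def Visible (s e : GVert → ℕ) (t : ℕ) (v : GVert) : Prop :=
  s v ≤ t ∧ t ≤ e v

/-- All twelve cycle vertices are visible at time `t`. -/
def CyclesVisible (s e : GVert → ℕ) (t : ℕ) : Prop :=
  ∀ k : Fin 4, Visible s e t (.a k) ∧ Visible s e t (.b k) ∧ Visible s e t (.c k)

/-- Orientation determinant of three points. -/
noncomputable def orientDet (x y z : ℝ × ℝ) : ℝ :=
  (y.1 - x.1) * (z.2 - x.2) - (y.2 - x.2) * (z.1 - x.1)

/-- The segments `x y` and `z w` meet. -/
def SegMeet (x y z w : ℝ × ℝ) : Prop := ∃ p, p ∈ segment ℝ x y ∩ segment ℝ z w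

lemma segMeet_of_comb {x y z w : ℝ × ℝ} {k l m n : ℝ} (hk : 0 ≤ k) (hl : 0 ≤ l)
    (hm : 0 ≤ m) (hn : 0 ≤ n) (hS : 0 < k + l) (he : k + l = m + n)
    (h1 : k * x.1 + l * y.1 = m * z.1 + n * w.1)
    (h2 : k * x.2 + l * y.2 = m * z.2 + n * w.2) : SegMeet x y z w := by
  refine ⟨(k / (k + l)) • x + (l / (k + l)) • y,
    ⟨k / (k + l), l / (k + l), by positivity, by positivity, by field_simp, rfl⟩,
    ⟨m / (k + l), n / (k + l), by positivity, by positivity, ?_, ?_⟩⟩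
  · rw [he] at hS ⊢; field_simp
  · ext
    · simp only [Prod.fst_add, Prod.smul_fst, smul_eq_mul]
      field_simp; linarith
    · simp only [Prod.snd_add, Prod.smul_snd, smul_eq_mul]
      field_simp; linarith

lemma collinear_param {q q' a : ℝ × ℝ} (hne : q ≠ q') (h : orientDet q q' a = 0) :
    ∃ s : ℝ, a.1 = q.1 + s * (q'.1 - q.1) ∧ a.2 = q.2 + s * (q'.2 - q.2) := by
  unfold orientDet at h
  by_cases h1 : q'.1 - q.1 = 0
  · have h2 : q'.2 - q.2 ≠ 0 := by
      intro h2
      exact hne (Prod.ext (by linarith) (by linarith))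
    refine ⟨(a.2 - q.2) / (q'.2 - q.2), ?_, by field_simp; ring⟩
    rw [h1] at h ⊢
    have : (q'.2 - q.2) * (a.1 - q.1) = 0 := by linarith
    rcases mul_eq_zero.1 this with h3 | h3
    · exact absurd h3 h2
    · linarith
  · refine ⟨(a.1 - q.1) / (q'.1 - q.1), by field_simp; ring, ?_⟩
    field_simp; linarith

lemma meet_collinear {a b q q' : ℝ × ℝ} (h1 : orientDet q q' a = 0)
    (h2 : orientDet q q' b = 0) : SegMeet a q b q' ∨ SegMeet a q' b q := by
  by_cases hne : q = q'
  · subst hne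
    exact Or.inl ⟨q, right_mem_segment _ _ _, right_mem_segment _ _ _⟩
  obtain ⟨s, hs1, hs2⟩ := collinear_param hne h1
  obtain ⟨t, ht1, ht2⟩ := collinear_param hne h2
  rcases le_total 1 s with hs | hs
  · left
    apply segMeet_of_comb (k := 1) (l := s - 1) (m := 0) (n := s) <;>
      linarith
  rcases le_total 1 t with ht | ht
  · right
    apply segMeet_of_comb (k := 0) (l := t) (m := 1) (n := t - 1) <;>
      linarith
  rcases le_total s 0 with hs0 | hs0
  · right
    apply segMeet_of_comb (k := 1) (l := - s) (m := 0) (n := 1 - s) <;>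
      linarith
  rcases le_total t 0 with ht0 | ht0
  · left
    apply segMeet_of_comb (k := 0) (l := 1 - t) (m := 1) (n := - t) <;>
      linarith
  rcases lt_or_ge s t with hst | hst
  · right
    apply segMeet_of_comb (k := t) (l := 0) (m := s) (n := t - s) <;>
      first | linarith | (rw [hs1, ht1]; ring) | (rw [hs2, ht2]; ring)
  · left
    rcases eq_or_lt_of_le hst with h | h
    · subst h
      refine ⟨a, left_mem_segment _ _ _, ?_⟩
      have : a = b := Prod.ext (by rw [hs1, ht1]) (by rw [hs2, ht2])
      rw [this]; exact left_mem_segment _ _ _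
    · apply segMeet_of_comb (k := 1 - t) (l := 0) (m := 1 - s) (n := s - t) <;>
        first | linarith | (rw [hs1, ht1]; ring) | (rw [hs2, ht2]; ring)

/-- If `a, b` lie weakly on one side of `q q'` and `q, q'` weakly on one side of `a b`,
then one of the two pairs of connecting segments meets. -/
lemma meet_of_sides {a b q q' : ℝ × ℝ}
    (h1 : (0 ≤ orientDet q q' a ∧ 0 ≤ orientDet q q' b) ∨
      (orientDet q q' a ≤ 0 ∧ orientDet q q' b ≤ 0))
    (h2 : (0 ≤ orientDet a b q ∧ 0 ≤ orientDet a b q') ∨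
      (orientDet a b q ≤ 0 ∧ orientDet a b q' ≤ 0)) :
    SegMeet a q b q' ∨ SegMeet a q' b q := by
  by_cases h0 : orientDet q q' a = 0 ∧ orientDet q q' b = 0
  · exact meet_collinear h0.1 h0.2
  have e1 : orientDet q q' a + orientDet a b q = orientDet q q' b + orientDet a b q' := by
    unfold orientDet; ring
  have e2 : orientDet q q' b * a.1 + orientDet a b q' * q.1
      = orientDet q q' a * b.1 + orientDet a b q * q'.1 := by
    unfold orientDet; ring
  have e3 : orientDet q q' b * a.2 + orientDet a b q' * q.2
      = orientDet q q' a * b.2 + orientDet a b q * q'.2 := by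
    unfold orientDet; ring
  generalize orientDet q q' a = α at *
  generalize orientDet q q' b = β at *
  generalize orientDet a b q = γ at *
  generalize orientDet a b q' = δ at *
  have hnz : ∀ x y : ℝ, (0 ≤ x ∧ 0 ≤ y) → ¬ (x = 0 ∧ y = 0) → 0 < x + y := by
    intro x y ⟨hx, hy⟩ h
    by_contra hc
    exact h ⟨by linarith, by linarith⟩
  rcases h1 with ⟨ha, hb⟩ | ⟨ha, hb⟩ <;> rcases h2 with ⟨hc, hd⟩ | ⟨hc, hd⟩
  · have := hnz α β ⟨ha, hb⟩ h0
    left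
    apply segMeet_of_comb (k := β) (l := δ) (m := α) (n := γ) <;> linarith
  · have := hnz α β ⟨ha, hb⟩ h0
    right
    apply segMeet_of_comb (k := β) (l := -γ) (m := α) (n := -δ) <;> linarith
  · have := hnz (-α) (-β) ⟨by linarith, by linarith⟩ (by simpa using h0)
    right
    apply segMeet_of_comb (k := -β) (l := γ) (m := -α) (n := δ) <;> linarith
  · have := hnz (-α) (-β) ⟨by linarith, by linarith⟩ (by simpa using h0)
    left
    apply segMeet_of_comb (k := -β) (l := -δ) (m := -α) (n := -γ) <;> linarith

open Classical in
/-- A straight-line drawing of `K_{3,8}` has two independent crossing edges. -/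
lemma k38_crossing (x y z : ℝ × ℝ) (Q : Fin 4 × Fin 2 → ℝ × ℝ) :
    ∃ i j, i ≠ j ∧ (SegMeet x (Q i) y (Q j) ∨ SegMeet y (Q i) z (Q j) ∨
      SegMeet z (Q i) x (Q j)) := by
  let f : Fin 4 × Fin 2 → Bool × Bool × Bool := fun i =>
    (decide (0 ≤ orientDet x y (Q i)), decide (0 ≤ orientDet y z (Q i)),
      decide (0 ≤ orientDet z x (Q i)))
  have hsum : ∀ p, orientDet x y p + orientDet y z p + orientDet z x p = orientDet x y z := by
    intro p; unfold orientDet; ring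
  have hninj : ¬ Function.Injective f := by
    intro hf
    have hb : Function.Bijective f :=
      (Fintype.bijective_iff_injective_and_card f).2 ⟨hf, by simp⟩
    obtain ⟨i, hi⟩ := hb.2 (true, true, true)
    obtain ⟨j, hj⟩ := hb.2 (false, false, false)
    simp only [f, Prod.mk.injEq, decide_eq_true_eq, decide_eq_false_iff_not, not_le] at hi hj
    have := hsum (Q i)
    have := hsum (Q j)
    linarith [hi.1, hi.2.1, hi.2.2, hj.1, hj.2.1, hj.2.2]
  simp only [Function.Injective, not_forall] at hninj
  obtain ⟨i, j, hij, hne⟩ := hninj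
  simp only [f, Prod.mk.injEq, decide_eq_decide] at hij
  obtain ⟨h1, h2, h3⟩ := hij
  have side : ∀ u v : ℝ, (0 ≤ u ↔ 0 ≤ v) → (0 ≤ u ∧ 0 ≤ v) ∨ (u ≤ 0 ∧ v ≤ 0) := by
    intro u v h
    rcases le_or_gt 0 u with hu | hu
    · exact Or.inl ⟨hu, h.1 hu⟩
    · refine Or.inr ⟨hu.le, ?_⟩
      by_contra hc
      exact absurd (h.2 (not_le.1 hc).le) (not_le.2 hu)
  have main : ∀ u v, ((0 ≤ orientDet (Q i) (Q j) u ∧ 0 ≤ orientDet (Q i) (Q j) v) ∨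
      (orientDet (Q i) (Q j) u ≤ 0 ∧ orientDet (Q i) (Q j) v ≤ 0)) →
      (0 ≤ orientDet u v (Q i) ↔ 0 ≤ orientDet u v (Q j)) →
      ∃ i j, i ≠ j ∧ SegMeet u (Q i) v (Q j) := by
    intro u v hs ho
    rcases meet_of_sides hs (side _ _ ho) with h | h
    · exact ⟨i, j, hne, h⟩
    · exact ⟨j, i, Ne.symm hne, h⟩
  have m1 := main x y
  have m2 := main y z
  have m3 := main z x
  have : (∃ i j, i ≠ j ∧ SegMeet x (Q i) y (Q j)) ∨ (∃ i j, i ≠ j ∧ SegMeet y (Q i) z (Q j)) ∨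
      (∃ i j, i ≠ j ∧ SegMeet z (Q i) x (Q j)) := by
    rcases le_total 0 (orientDet (Q i) (Q j) x) with hx | hx <;>
    rcases le_total 0 (orientDet (Q i) (Q j) y) with hy | hy <;>
    rcases le_total 0 (orientDet (Q i) (Q j) z) with hz | hz <;>
    first
      | exact Or.inl (m1 (Or.inl ⟨hx, hy⟩) h1)
      | exact Or.inl (m1 (Or.inr ⟨hx, hy⟩) h1)
      | exact Or.inr (Or.inl (m2 (Or.inl ⟨hy, hz⟩) h2))
      | exact Or.inr (Or.inl (m2 (Or.inr ⟨hy, hz⟩) h2))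
      | exact Or.inr (Or.inr (m3 (Or.inl ⟨hz, hx⟩) h3))
      | exact Or.inr (Or.inr (m3 (Or.inr ⟨hz, hx⟩) h3))
  rcases this with ⟨i, j, h, h'⟩ | ⟨i, j, h, h'⟩ | ⟨i, j, h, h'⟩
  · exact ⟨i, j, h, Or.inl h'⟩
  · exact ⟨i, j, h, Or.inr (Or.inl h')⟩
  · exact ⟨i, j, h, Or.inr (Or.inr h')⟩

lemma cycle_cooccurs (len : ℕ) (s e : GVert → ℕ) (D : GVert → ℝ × ℝ)
    (hSP : IsGeomStoryplan GraphG len s e D) (f : Fin 4 → GVert)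
    (hinj : Function.Injective f) (hadj : ∀ i, GraphG.Adj (f i) (f (i + 1)))
    (hq : ∀ i j k, GraphG.Adj (f k) (.q i j)) :
    ∃ t, ∀ k : Fin 4, Visible s e t (f k) := by
  obtain ⟨-, hint, hco, hpl⟩ := hSP
  have hle : ∀ u v, GraphG.Adj u v → s u ≤ e v ∧ s v ≤ e u := by
    intro u v h
    obtain ⟨t, h1, h2, h3, h4⟩ := hco u v h
    exact ⟨by omega, by omega⟩
  by_cases hall : ∀ i j, s (f i) ≤ e (f j)
  · refine ⟨Finset.univ.sup (fun i => s (f i)), fun k => ⟨?_, ?_⟩⟩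
    · exact Finset.le_sup (f := fun i => s (f i)) (Finset.mem_univ k)
    · exact Finset.sup_le (fun i _ => hall i k)
  exfalso
  push Not at hall
  obtain ⟨j, i, hij⟩ := hall
  have hj : j = i + 2 := by
    have h1 : j ≠ i := by rintro rfl; have := (hint (f j)).2.1; omega
    have h2 : j ≠ i + 1 := by rintro rfl; have := hle _ _ (hadj i); omega
    have h3 : i ≠ j + 1 := by rintro rfl; have := hle _ _ (hadj j); omega
    clear hij
    revert i j; decide
  subst hj
  have a1 := hle _ _ (hadj i)
  have a2 := hle _ _ (hadj (i + 1))
  have a3 := hle _ _ (hadj (i + 2))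
  have a4 := hle _ _ (hadj (i + 3))
  have r1 : i + 1 + 1 = i + 2 := (by decide : ∀ i : Fin 4, i + 1 + 1 = i + 2) i
  have r2 : i + 2 + 1 = i + 3 := (by decide : ∀ i : Fin 4, i + 2 + 1 = i + 3) i
  have r3 : i + 3 + 1 = i := (by decide : ∀ i : Fin 4, i + 3 + 1 = i) i
  rw [r1] at a2
  rw [r2] at a3
  rw [r3] at a4
  have hI := hint (f i)
  have v0 : s (f i) ≤ e (f i) ∧ e (f i) ≤ e (f i) := by omega
  have v1 : s (f (i + 1)) ≤ e (f i) ∧ e (f i) ≤ e (f (i + 1)) := by omega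
  have v3 : s (f (i + 3)) ≤ e (f i) ∧ e (f i) ≤ e (f (i + 3)) := by omega
  have vq : ∀ k l, s (.q k l) ≤ e (f i) ∧ e (f i) ≤ e (.q k l) := by
    intro k l
    have := hle _ _ (hq k l i)
    have := hle _ _ (hq k l (i + 2))
    omega
  obtain ⟨-, -, hcr⟩ := hpl (e (f i)) (by omega) (by omega)
  have key : ∀ (k l : Fin 4) (m n : Fin 4 × Fin 2), k ≠ l → m ≠ n →
      (s (f k) ≤ e (f i) ∧ e (f i) ≤ e (f k)) → (s (f l) ≤ e (f i) ∧ e (f i) ≤ e (f l)) →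
      ¬ SegMeet (D (f k)) (D (.q m.1 m.2)) (D (f l)) (D (.q n.1 n.2)) := by
    rintro k l m n hkl hmn hk hl ⟨p, hp⟩
    have n1 : f k ≠ f l := fun h => hkl (hinj h)
    have n2 : f k ≠ .q n.1 n.2 := (hq _ _ _).ne
    have n3 : GVert.q m.1 m.2 ≠ f l := (hq _ _ _).ne'
    have n4 : GVert.q m.1 m.2 ≠ .q n.1 n.2 := by
      intro h
      injection h with h1 h2
      exact hmn (Prod.ext h1 h2)
    obtain ⟨z, hz1, hz2, -⟩ := hcr (f k) (.q m.1 m.2) (f l) (.q n.1 n.2) (hq _ _ _) (hq _ _ _)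
      hk (vq _ _) hl (vq _ _) (by tauto) p hp
    rcases hz1 with rfl | rfl <;> rcases hz2 with h | h <;> contradiction
  have d1 : i ≠ i + 1 := (by decide : ∀ i : Fin 4, i ≠ i + 1) i
  have d2 : i + 1 ≠ i + 3 := (by decide : ∀ i : Fin 4, i + 1 ≠ i + 3) i
  have d3 : i + 3 ≠ i := (by decide : ∀ i : Fin 4, i + 3 ≠ i) i
  obtain ⟨m, n, hmn, h | h | h⟩ := k38_crossing (D (f i)) (D (f (i + 1))) (D (f (i + 3)))
    (fun m => D (.q m.1 m.2))
  · exact key _ _ m n d1 hmn v0 v1 h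
  · exact key _ _ m n d2 hmn v1 v3 h
  · exact key _ _ m n d3 hmn v3 v0 h

/-- In every planar geometric storyplan of `G`, for each of the
three 4-cycles `A`, `B`, `C` there is a time step at which all four of its
vertices are simultaneously visible. -/
theorem each_cycle_cooccurs
    (len : ℕ) (s e : GVert → ℕ) (D : GVert → ℝ × ℝ)
    (hSP : IsGeomStoryplan GraphG len s e D) :
    (∃ t, ∀ k : Fin 4, Visible s e t (.a k)) ∧
    (∃ t, ∀ k : Fin 4, Visible s e t (.b k)) ∧
    (∃ t, ∀ k : Fin 4, Visible s e t (.c k)) := by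
  refine ⟨cycle_cooccurs len s e D hSP .a ?_ ?_ ?_, cycle_cooccurs len s e D hSP .b ?_ ?_ ?_,
    cycle_cooccurs len s e D hSP .c ?_ ?_ ?_⟩
  all_goals first
    | (intro x y h; injection h)
    | (intro i; simp [GraphG, SimpleGraph.fromRel_adj, GRel])
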